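/- Let E be a finite-dimensional real inner product space, f : E → ℝ smooth, and let x* be a critical point of f. (a) If x* is a strict local maximum of f, then x* is a stable equilibrium of the gradient flow ẋ = ∇f(x): for every neighbourhood U of x* there is a neighbourhood V of x* such that every maximal solution with x(0) ∈ V exists for all t ≥ 0, remains in U, and has nonempty ω-limit set contained in U. (b) If x* is a strict local maximum of f and additionally an isolated critical point of f, then x* is asymptotically stable: there is a neighbourhood V of x* such that every maximal solution with x(0) ∈ V exists for all t ≥ 0 and converges to x* as t → +∞. -/

import Mathlib

open Filter Topology

open scoped NNReal in
/-- A bounded Lipschitz autonomous vector field is complete. -/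
theorem exists_forall_hasDerivAt_of_lipschitzWith {E : Type*} [NormedAddCommGroup E]
    [NormedSpace ℝ E] [CompleteSpace E] {v : E → E} {K L : ℝ≥0} (hv : LipschitzWith K v)
    (hL : ∀ y, ‖v y‖ ≤ L) (x₀ : E) :
    ∃ x : ℝ → E, x 0 = x₀ ∧ ∀ t, HasDerivAt x (v (x t)) t := by
  have hloc : ∀ a : ℝ, ∃ γ : ℝ → E, γ 0 = x₀ ∧
      ∀ t ∈ Set.Ioo (-a) a, HasDerivAt γ (v (γ t)) t := by
    intro a
    rcases le_or_gt a 0 with ha | ha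
    · exact ⟨fun _ ↦ x₀, rfl, fun t ht ↦ by linarith [ht.1, ht.2]⟩
    lift a to ℝ≥0 using ha.le
    have hp : IsPicardLindelof (fun _ ↦ v) (tmin := -a) (tmax := a)
        ⟨0, by linarith, ha.le⟩ x₀ (L * a) 0 L K :=
      .of_time_independent (fun y _ ↦ hL y) hv.lipschitzOnWith (by simp)
    obtain ⟨γ, h0, hγ⟩ := hp.exists_eq_forall_mem_Icc_hasDerivWithinAt₀
    exact ⟨γ, h0, fun t ht ↦
      (hγ t (Set.Ioo_subset_Icc_self ht)).hasDerivAt (Icc_mem_nhds ht.1 ht.2)⟩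
  choose γ h0 hγ using hloc
  have heq : ∀ a b : ℝ, 0 < a → a ≤ b → Set.EqOn (γ a) (γ b) (Set.Ioo (-a) a) := by
    intro a b ha hab
    refine ODE_solution_unique_of_mem_Ioo (v := fun _ ↦ v) (s := fun _ ↦ Set.univ) (t₀ := 0)
      (fun _ _ ↦ hv.lipschitzOnWith) ⟨by linarith, ha⟩ (fun t ht ↦ ⟨hγ a t ht, trivial⟩)
      (fun t ht ↦ ⟨hγ b t ⟨by linarith [ht.1], by linarith [ht.2]⟩, trivial⟩)
      ((h0 a).trans (h0 b).symm)
  refine ⟨fun t ↦ γ (|t| + 1) t, h0 _, fun t ↦ ?_⟩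
  have ht : t ∈ Set.Ioo (-(|t| + 1)) (|t| + 1) := by
    rw [Set.mem_Ioo, ← abs_lt]; linarith
  refine (hγ (|t| + 1) t ht).congr_of_eventuallyEq ?_
  filter_upwards [Ioo_mem_nhds ht.1 ht.2] with s hs
  rcases le_total |s| |t| with h | h
  · exact heq _ _ (by positivity) (by linarith) (by rw [Set.mem_Ioo, ← abs_lt]; linarith)
  · exact (heq _ _ (by positivity) (by linarith) hs).symm

/-- A curve along which `f` increases cannot leave a ball on whose boundary `f` is smaller. -/
theorem mem_ball_of_monotoneOn {X : Type*} [PseudoMetricSpace X] {f : X → ℝ} {x : ℝ → X}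
    {p : X} {r m : ℝ}
    (hcont : ContinuousOn x (Set.Ici 0)) (hmono : MonotoneOn (fun t ↦ f (x t)) (Set.Ici 0))
    (hm : ∀ y ∈ Metric.sphere p r, f y ≤ m) (h0 : x 0 ∈ Metric.ball p r) (hm0 : m < f (x 0))
    {t : ℝ} (ht : 0 ≤ t) : x t ∈ Metric.ball p r := by
  by_contra hout
  have hd : ContinuousOn (fun s ↦ dist (x s) p) (Set.Icc 0 t) :=
    continuous_dist.comp_continuousOn
      ((hcont.mono Set.Icc_subset_Ici_self).prodMk continuousOn_const)
  obtain ⟨s, hs, hsr⟩ := intermediate_value_Icc ht hd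
    (show r ∈ Set.Icc _ _ from ⟨(Metric.mem_ball.1 h0).le, not_lt.1 hout⟩)
  have h1 := hm _ (Metric.mem_sphere.2 hsr)
  have h2 : f (x 0) ≤ f (x s) := hmono (Set.mem_Ici.2 le_rfl) hs.1 hs.1
  linarith

section GradientFlow

variable {E : Type*} [NormedAddCommGroup E] [InnerProductSpace ℝ E]

theorem ContDiff.gradient [CompleteSpace E] {f : E → ℝ} (hf : ContDiff ℝ (⊤ : ℕ∞) f) :
    ContDiff ℝ 1 (gradient f) :=
  (InnerProductSpace.toDual ℝ E).symm.toContinuousLinearEquiv.contDiff.comp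
    (hf.fderiv_right (m := 1) (by norm_cast))

/-- The derivative of `f` along a curve moving in the direction of a multiple of `∇f`. -/
theorem HasDerivAt.comp_smul_gradient [CompleteSpace E] {f : E → ℝ} {x : ℝ → E} {t c : ℝ}
    (hf : DifferentiableAt ℝ f (x t)) (hx : HasDerivAt x (c • gradient f (x t)) t) :
    HasDerivAt (fun s ↦ f (x s)) (c * ‖gradient f (x t)‖ ^ 2) t := by
  have h := hf.hasGradientAt.hasFDerivAt.comp_hasDerivAt t hx
  rw [InnerProductSpace.toDual_apply_apply, inner_smul_right, real_inner_self_eq_norm_sq] at h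
  exact h

theorem monotoneOn_comp_of_hasDerivAt_smul_gradient [CompleteSpace E] {f : E → ℝ}
    (hf : Differentiable ℝ f) {x : ℝ → E} {c : ℝ → ℝ} (hc : ∀ t, 0 ≤ c t)
    (hx : ∀ t, 0 ≤ t → HasDerivAt x (c t • gradient f (x t)) t) :
    MonotoneOn (fun t ↦ f (x t)) (Set.Ici 0) := by
  have hd : ∀ t, 0 ≤ t → HasDerivAt (fun s ↦ f (x s)) (c t * ‖gradient f (x t)‖ ^ 2) t :=
    fun t ht ↦ (hx t ht).comp_smul_gradient (hf _)
  refine monotoneOn_of_deriv_nonneg (convex_Ici 0)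
    (fun t ht ↦ (hd t ht).continuousAt.continuousWithinAt) ?_ ?_ <;>
  · rw [interior_Ici]
    intro t ht
    first
    | exact (hd t (le_of_lt ht)).differentiableAt.differentiableWithinAt
    | rw [(hd t (le_of_lt ht)).deriv]; exact mul_nonneg (hc t) (sq_nonneg _)

variable [FiniteDimensional ℝ E]

/-- Every cluster point of a bounded trajectory of a gradient flow is a critical point. -/
theorem gradient_eq_zero_of_mapClusterPt {f : E → ℝ} (hf : Differentiable ℝ f)
    (hg : Continuous (gradient f)) {x : ℝ → E} {K : Set E} (hK : IsCompact K)
    (hx : ∀ t, 0 ≤ t → HasDerivAt x (gradient f (x t)) t) (hxK : ∀ t, 0 ≤ t → x t ∈ K) {p : E}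
    (hp : MapClusterPt p atTop x) : gradient f p = 0 := by
  by_contra hne
  have hd : ∀ t, 0 ≤ t → HasDerivAt (fun s ↦ f (x s)) (‖gradient f (x t)‖ ^ 2) t := by
    intro t ht
    have h : HasDerivAt x ((1 : ℝ) • gradient f (x t)) t := by simpa using hx t ht
    simpa using h.comp_smul_gradient (hf _)
  have hmono := monotoneOn_comp_of_hasDerivAt_smul_gradient hf (c := fun _ ↦ 1)
    (fun _ ↦ zero_le_one) (fun t ht ↦ by simpa using hx t ht)
  have hle : ∀ t, 0 ≤ t → f (x t) ≤ f p := by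
    intro t ht
    by_contra! hlt
    obtain ⟨s, hs, hts⟩ := ((hp.frequently
      (hf.continuous.continuousAt.eventually (gt_mem_nhds hlt))).and_eventually
        (eventually_ge_atTop t)).exists
    exact absurd (hmono ht (ht.trans hts) hts) (not_le.2 hs)
  obtain ⟨M, hM⟩ := hK.exists_bound_of_continuousOn hg.continuousOn
  have hM0 : 0 ≤ M := (norm_nonneg _).trans (hM _ (hxK 0 le_rfl))
  have hpos : 0 < ‖gradient f p‖ ^ 2 := by positivity
  obtain ⟨c, hc0, hc⟩ := exists_between hpos
  obtain ⟨δ, hδ, hball⟩ := Metric.eventually_nhds_iff.1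
    ((hg.norm.pow 2).continuousAt.eventually (lt_mem_nhds hc))
  set τ := δ / (2 * (M + 1)) with hτ
  have hτ0 : 0 < τ := by positivity
  have hMτ : M * τ ≤ δ / 2 := by
    have h : (M + 1) * τ = δ / 2 := by rw [hτ]; field_simp
    linarith
  obtain ⟨s, ⟨hs1, hs2⟩, hs0⟩ := ((hp.frequently
    (Eventually.and (Metric.ball_mem_nhds p (half_pos hδ)) (hf.continuous.continuousAt.eventually
      (lt_mem_nhds (show f p - c * τ < f p by linarith [mul_pos hc0 hτ0]))))).and_eventually
        (eventually_ge_atTop 0)).exists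
  have hnear : ∀ u ∈ Set.Icc s (s + τ), c < ‖gradient f (x u)‖ ^ 2 := by
    intro u hu
    have h1 := norm_image_sub_le_of_norm_deriv_le_segment' (f := x) (a := s) (b := s + τ)
      (fun w hw ↦ (hx w (hs0.trans hw.1)).hasDerivWithinAt)
      (fun w hw ↦ hM _ (hxK w (hs0.trans hw.1))) u hu
    have h2 : M * (u - s) ≤ M * τ := mul_le_mul_of_nonneg_left (by linarith [hu.2]) hM0
    apply hball
    have h3 := dist_triangle (x u) (x s) p
    rw [dist_eq_norm (x u) (x s)] at h3
    have h4 : dist (x s) p < δ / 2 := hs1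
    linarith
  have hinc := (convex_Icc s (s + τ)).mul_sub_le_image_sub_of_le_deriv (C := c)
    (f := fun t ↦ f (x t))
    (fun u hu ↦ (hd u (hs0.trans hu.1)).continuousAt.continuousWithinAt)
    (fun u hu ↦ (hd u (hs0.trans (interior_subset hu).1)).differentiableAt.differentiableWithinAt)
    (fun u hu ↦ by
      rw [(hd u (hs0.trans (interior_subset hu).1)).deriv]
      exact (hnear u (interior_subset hu)).le)
    s (Set.left_mem_Icc.2 (by linarith)) (s + τ) (Set.right_mem_Icc.2 (by linarith))
    (by linarith)
  have := hle (s + τ) (by linarith)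
  simp only [add_sub_cancel_left] at hinc
  linarith

/-- Lyapunov stability of a strict local maximum under the gradient flow. -/
theorem exists_nhds_gradient_flow_stable {f : E → ℝ} (hf : ContDiff ℝ (⊤ : ℕ∞) f) {p : E}
    (hmax : ∃ W ∈ 𝓝 p, ∀ y ∈ W, y ≠ p → f y < f p) {U : Set E} (hU : U ∈ 𝓝 p) :
    ∃ V ∈ 𝓝 p,
      (∀ x₀ ∈ V, ∃ x : ℝ → E, x 0 = x₀ ∧
        ∀ t : ℝ, 0 ≤ t → HasDerivAt x (gradient f (x t)) t) ∧
      ∀ x : ℝ → E, (∀ t : ℝ, 0 ≤ t → HasDerivAt x (gradient f (x t)) t) →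
        x 0 ∈ V → ∀ t : ℝ, 0 ≤ t → x t ∈ U := by
  obtain ⟨W, hW, hWmax⟩ := hmax
  have hdiff : Differentiable ℝ f := hf.differentiable (by simp)
  obtain ⟨r, hr, hrUW⟩ := Metric.nhds_basis_closedBall.mem_iff.1 (inter_mem hU hW)
  obtain ⟨m, hmp, hm⟩ : ∃ m < f p, ∀ y ∈ Metric.sphere p r, f y ≤ m := by
    rcases (Metric.sphere p r).eq_empty_or_nonempty with h | h
    · exact ⟨f p - 1, by linarith, by simp [h]⟩
    · obtain ⟨q, hq, hqmax⟩ :=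
        (isCompact_sphere p r).exists_isMaxOn h hf.continuous.continuousOn
      exact ⟨f q, hWmax q (hrUW (Metric.sphere_subset_closedBall hq)).2
        (Metric.ne_of_mem_sphere hq hr.ne'), hqmax⟩
  refine ⟨Metric.ball p r ∩ {y | m < f y}, inter_mem (Metric.ball_mem_nhds p hr)
    (hf.continuous.continuousAt.eventually (lt_mem_nhds hmp)), ?_, ?_⟩
  · rintro x₀ ⟨hx₀, hmx₀⟩
    let χ : ContDiffBump p := ⟨r, r + 1, hr, by linarith⟩
    have hvd : ContDiff ℝ 1 (fun y ↦ χ y • gradient f y) := χ.contDiff.smul hf.gradient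
    have hvs : HasCompactSupport (fun y ↦ χ y • gradient f y) := χ.hasCompactSupport.smul_right
    obtain ⟨K, hK⟩ := hvd.lipschitzWith_of_hasCompactSupport hvs one_ne_zero
    obtain ⟨L, hL⟩ := hvs.exists_bound_of_continuous hvd.continuous
    obtain ⟨x, h0, hx⟩ := exists_forall_hasDerivAt_of_lipschitzWith hK
      (fun y ↦ (hL y).trans (Real.le_coe_toNNReal L)) x₀
    refine ⟨x, h0, fun t ht ↦ ?_⟩
    have hball := mem_ball_of_monotoneOn (fun t _ ↦ (hx t).continuousAt.continuousWithinAt)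
      (monotoneOn_comp_of_hasDerivAt_smul_gradient hdiff (c := fun t ↦ χ (x t))
        (fun _ ↦ χ.nonneg) (fun t _ ↦ hx t)) hm (h0 ▸ hx₀) (h0 ▸ hmx₀) ht
    simpa [χ.one_of_mem_closedBall (Metric.ball_subset_closedBall hball)] using hx t
  · rintro x hx ⟨hx₀, hmx₀⟩ t ht
    refine (hrUW (Metric.ball_subset_closedBall ?_)).1
    exact mem_ball_of_monotoneOn (fun t ht ↦ (hx t ht).continuousAt.continuousWithinAt)
      (monotoneOn_comp_of_hasDerivAt_smul_gradient hdiff (c := fun _ ↦ 1)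
        (fun _ ↦ zero_le_one) (fun t ht ↦ by simpa using hx t ht)) hm hx₀ hmx₀ ht

end GradientFlow

/-- Stability of strict local maxima for gradient flows, with `f` itself as Lyapunov
function. (a) If `xs` is a strict local maximum of the smooth function `f`, then `xs` is a
stable equilibrium of `ẋ = ∇f(x)`: for every neighbourhood `U` of `xs` there is a
neighbourhood `V` such that from every point of `V` there starts a solution defined for all
`t ≥ 0` remaining in `U`, and every solution defined for all `t ≥ 0` starting in `V`
remains in `U` and has a nonempty ω-limit set contained in `U`. (b) If moreover `xs` is an
isolated critical point, then `xs` is asymptotically stable: there is a neighbourhood `V`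
such that from every point of `V` there starts a solution defined for all `t ≥ 0`, and
every such solution starting in `V` converges to `xs`. -/
theorem stmt15 (E : Type*) [NormedAddCommGroup E] [InnerProductSpace ℝ E]
    [FiniteDimensional ℝ E]
    (f : E → ℝ) (hf : ContDiff ℝ (⊤ : ℕ∞) f) (xs : E) (hcrit : gradient f xs = 0)
    (hmax : ∃ W ∈ 𝓝 xs, ∀ y ∈ W, y ≠ xs → f y < f xs) :
    (∀ U ∈ 𝓝 xs, ∃ V ∈ 𝓝 xs,
      (∀ x₀ ∈ V, ∃ x : ℝ → E, x 0 = x₀ ∧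
        (∀ t : ℝ, 0 ≤ t → HasDerivAt x (gradient f (x t)) t) ∧
        (∀ t : ℝ, 0 ≤ t → x t ∈ U)) ∧
      (∀ x : ℝ → E, (∀ t : ℝ, 0 ≤ t → HasDerivAt x (gradient f (x t)) t) →
        x 0 ∈ V →
        (∀ t : ℝ, 0 ≤ t → x t ∈ U) ∧
        (⋂ T : ℝ, closure (x '' Set.Ici T)).Nonempty ∧
        (⋂ T : ℝ, closure (x '' Set.Ici T)) ⊆ U)) ∧
    ((∃ W ∈ 𝓝 xs, ∀ y ∈ W, gradient f y = 0 → y = xs) →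
      ∃ V ∈ 𝓝 xs,
        (∀ x₀ ∈ V, ∃ x : ℝ → E, x 0 = x₀ ∧
          ∀ t : ℝ, 0 ≤ t → HasDerivAt x (gradient f (x t)) t) ∧
        (∀ x : ℝ → E, (∀ t : ℝ, 0 ≤ t → HasDerivAt x (gradient f (x t)) t) →
          x 0 ∈ V → Tendsto x atTop (𝓝 xs))) := by
  constructor
  · intro U hU
    obtain ⟨K, hK, hKU, hKc⟩ := local_compact_nhds hU
    obtain ⟨V, hV, hex, hstab⟩ := exists_nhds_gradient_flow_stable hf hmax hK
    refine ⟨V, hV, fun x₀ hx₀ ↦ ?_, fun x hx h0 ↦ ⟨fun t ht ↦ hKU (hstab x hx h0 t ht), ?_, ?_⟩⟩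
    · obtain ⟨x, h0, hx⟩ := hex x₀ hx₀
      exact ⟨x, h0, hx, fun t ht ↦ hKU (hstab x hx (h0 ▸ hx₀) t ht)⟩
    · obtain ⟨p, -, hp⟩ := hKc.exists_mapClusterPt (f := atTop) (u := x)
        (le_principal_iff.2 (mem_map.2 ((eventually_ge_atTop 0).mono (hstab x hx h0))))
      refine ⟨p, Set.mem_iInter.2 fun T ↦ mem_closure_iff_nhds.2 fun S hS ↦ ?_⟩
      obtain ⟨t, htS, htT⟩ := ((hp.frequently hS).and_eventually (eventually_ge_atTop T)).exists
      exact ⟨x t, htS, t, htT, rfl⟩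
    · refine (Set.iInter_subset _ 0).trans (Set.Subset.trans ?_ hKU)
      exact closure_minimal (Set.image_subset_iff.2 (hstab x hx h0)) hKc.isClosed
  · rintro ⟨W, hW, hcritW⟩
    obtain ⟨K, hK, hKW, hKc⟩ := local_compact_nhds hW
    obtain ⟨V, hV, hex, hstab⟩ := exists_nhds_gradient_flow_stable hf hmax hK
    refine ⟨V, hV, hex, fun x hx h0 ↦ hKc.tendsto_nhds_of_unique_mapClusterPt
      ((eventually_ge_atTop 0).mono (hstab x hx h0)) fun p hpK hp ↦ hcritW p (hKW hpK) ?_⟩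
    exact gradient_eq_zero_of_mapClusterPt (hf.differentiable (by simp)) hf.gradient.continuous
      hKc hx (hstab x hx h0) hp
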